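/- arXiv:math/0610747 — 2 statements merged into one kernel-verified Lean document; each statement's English description precedes it below -/
import Mathlib

section
/- Let X1, X2, X3 be Polish spaces, let η1 and η2 be independent random elements with values in X1 and X2 respectively, and let f : X1 × X2 → X3 be Borel measurable. Fix x2⁰ ∈ X2 and δ > 0, and set D_δ := {x ∈ X2 : d_TV(law of f(η1, x), law of f(η1, x2⁰)) ≥ δ}; assume D_δ is a Borel subset of X2. Then the strong mixing coefficient α of the σ-algebras σ{f(η1, η2)} and σ{η2} satisfies α ≤ 2δ + 2·P(η2 ∈ D_δ). -/
open MeasureTheory ProbabilityTheory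

/-- Total variation distance between two laws: the supremum over measurable sets `A`
of `|μ A - ν A|`. -/
noncomputable def tvDist {X : Type*} [MeasurableSpace X] (μ ν : Measure X) : ℝ :=
  ⨆ A : {s : Set X // MeasurableSet s}, |(μ A.1).toReal - (ν A.1).toReal|

/-- The strong mixing coefficient of two sub-σ-algebras `F`, `G`:
`α(F, G) := sup {|P(A ∩ B) − P(A)·P(B)| : A ∈ F, B ∈ G}`. -/
noncomputable def alphaMix {Ω : Type*} [MeasurableSpace Ω] (P : Measure Ω)
    (F G : MeasurableSpace Ω) : ℝ :=
  ⨆ q : {AB : Set Ω × Set Ω // MeasurableSet[F] AB.1 ∧ MeasurableSet[G] AB.2},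
    |(P (q.1.1 ∩ q.1.2)).toReal - (P q.1.1).toReal * (P q.1.2).toReal|

/-- Fubini for the part of a measurable set lying over a measurable set of second coordinates. -/
lemma toReal_prod_inter_snd_preimage {X Y : Type*} [MeasurableSpace X] [MeasurableSpace Y]
    (μ : Measure X) (ν : Measure Y) [IsProbabilityMeasure μ] [IsProbabilityMeasure ν]
    {E : Set (X × Y)} {T : Set Y} (hE : MeasurableSet E) (hT : MeasurableSet T) :
    (μ.prod ν (E ∩ Prod.snd ⁻¹' T)).toReal
      = ∫ y in T, (μ ((fun x => (x, y)) ⁻¹' E)).toReal ∂ν := by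
  rw [integral_toReal (measurable_measure_prodMk_right hE).aemeasurable
      (Filter.Eventually.of_forall fun y => measure_lt_top _ _),
    Measure.prod_apply_symm (hE.inter (measurable_snd hT)), ← lintegral_indicator hT]
  congr 2
  ext y
  by_cases hy : y ∈ T <;> simp [hy, Set.preimage_inter, Set.preimage_preimage]

/-- The difference of the masses of a measurable set is at most the total variation distance. -/
lemma abs_sub_le_tvDist {X : Type*} [MeasurableSpace X] (μ ν : Measure X)
    [IsProbabilityMeasure μ] [IsProbabilityMeasure ν] {S : Set X} (hS : MeasurableSet S) :
    |(μ S).toReal - (ν S).toReal| ≤ tvDist μ ν := by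
  refine le_ciSup (f := fun A : {s : Set X // MeasurableSet s} =>
    |(μ A.1).toReal - (ν A.1).toReal|) ⟨1, ?_⟩ ⟨S, hS⟩
  rintro _ ⟨A, rfl⟩
  exact abs_sub_le_of_nonneg_of_le ENNReal.toReal_nonneg measureReal_le_one
    ENNReal.toReal_nonneg measureReal_le_one

/-- A function within `δ` of a constant outside `D`, and within `δ + 1` on `D`,
is nearly uncorrelated with every indicator. -/
lemma abs_setIntegral_sub_integral_mul_le {Y : Type*} [MeasurableSpace Y] (ν : Measure Y)
    [IsProbabilityMeasure ν] {g : Y → ℝ} (hg : Integrable g ν) {c δ : ℝ} {D T : Set Y}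
    (hD : MeasurableSet D)
    (hgc : ∀ y, |g y - c| ≤ δ + D.indicator 1 y) :
    |∫ y in T, g y ∂ν - (∫ y, g y ∂ν) * ν.real T| ≤ 2 * δ + 2 * ν.real D := by
  have h_one : Integrable (D.indicator (1 : Y → ℝ)) ν := (integrable_const 1).indicator hD
  have h_sub : Integrable (fun y => g y - c) ν := hg.sub (integrable_const c)
  have h_total : ∫ y, |g y - c| ∂ν ≤ δ + ν.real D := by
    refine (integral_mono h_sub.abs ((integrable_const δ).add h_one) hgc).trans_eq ?_
    simp [integral_add (integrable_const δ) h_one, integral_indicator_one hD]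
  have h_part : |∫ y in T, (g y - c) ∂ν| ≤ δ + ν.real D :=
    (abs_integral_le_integral_abs.trans (setIntegral_le_integral h_sub.abs
      (Filter.Eventually.of_forall fun y => abs_nonneg _))).trans h_total
  have h_whole : |∫ y, (g y - c) ∂ν| ≤ δ + ν.real D :=
    abs_integral_le_integral_abs.trans h_total
  have h_decomp : ∫ y in T, g y ∂ν - (∫ y, g y ∂ν) * ν.real T
      = ∫ y in T, (g y - c) ∂ν - (∫ y, (g y - c) ∂ν) * ν.real T := by
    rw [integral_sub hg.integrableOn (integrable_const c), integral_sub hg (integrable_const c)]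
    simp
    ring
  have h_mul : |(∫ y, (g y - c) ∂ν) * ν.real T| ≤ δ + ν.real D := by
    rw [abs_mul, abs_of_nonneg measureReal_nonneg]
    exact (mul_le_of_le_one_right (abs_nonneg _) measureReal_le_one).trans h_whole
  rw [h_decomp]
  linarith [abs_sub (∫ y in T, (g y - c) ∂ν) ((∫ y, (g y - c) ∂ν) * ν.real T)]

/-- if `η1`, `η2` are independent random elements of Polish spaces `X1`, `X2`,
`f : X1 × X2 → X3` is Borel, `x20 ∈ X2`, `δ > 0` and
`D = {x ∈ X2 : d_TV(law f(η1, x), law f(η1, x20)) ≥ δ}` is Borel, then the strong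
mixing coefficient of `σ{f(η1, η2)}` and `σ{η2}` is at most `2δ + 2 P(η2 ∈ D)`. -/
theorem stmt0
    {Ω X1 X2 X3 : Type*} [MeasurableSpace Ω]
    [MeasurableSpace X1] [TopologicalSpace X1] [PolishSpace X1] [BorelSpace X1]
    [MeasurableSpace X2] [TopologicalSpace X2] [PolishSpace X2] [BorelSpace X2]
    [MeasurableSpace X3] [TopologicalSpace X3] [PolishSpace X3] [BorelSpace X3]
    (P : Measure Ω) [IsProbabilityMeasure P]
    (η1 : Ω → X1) (η2 : Ω → X2) (hη1 : Measurable η1) (hη2 : Measurable η2)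
    (hindep : IndepFun η1 η2 P)
    (f : X1 × X2 → X3) (hf : Measurable f)
    (x20 : X2) (δ : ℝ) (hδ : 0 < δ)
    (D : Set X2)
    (hD : D = {x : X2 |
      δ ≤ tvDist (P.map (fun ω => f (η1 ω, x))) (P.map (fun ω => f (η1 ω, x20)))})
    (hDmeas : MeasurableSet D) :
    alphaMix P (MeasurableSpace.comap (fun ω => f (η1 ω, η2 ω)) inferInstance)
        (MeasurableSpace.comap η2 inferInstance)
      ≤ 2 * δ + 2 * (P (η2 ⁻¹' D)).toReal := by
  refine Real.iSup_le ?_ (by positivity)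
  rintro ⟨⟨A, B⟩, hA, hB⟩
  obtain ⟨S, hS, rfl⟩ : ∃ S, MeasurableSet S ∧ (fun ω => f (η1 ω, η2 ω)) ⁻¹' S = A := hA
  obtain ⟨T, hT, rfl⟩ : ∃ T, MeasurableSet T ∧ η2 ⁻¹' T = B := hB
  have := Measure.isProbabilityMeasure_map hη1.aemeasurable (μ := P)
  have := Measure.isProbabilityMeasure_map hη2.aemeasurable (μ := P)
  have hpair : Measurable fun ω => (η1 ω, η2 ω) := hη1.prodMk hη2
  have hE : MeasurableSet (f ⁻¹' S) := hf hS
  have h_slice : ∀ x, Measurable fun ω => f (η1 ω, x) := fun x =>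
    hf.comp (hη1.prodMk measurable_const)
  have h_inter : ∀ U : Set X2, MeasurableSet U →
      (P ((fun ω => f (η1 ω, η2 ω)) ⁻¹' S ∩ η2 ⁻¹' U)).toReal
        = ∫ x in U, (P.map η1 ((fun y => (y, x)) ⁻¹' (f ⁻¹' S))).toReal ∂(P.map η2) := by
    intro U hU
    rw [← toReal_prod_inter_snd_preimage _ _ hE hU,
      ← (indepFun_iff_map_prod_eq_prod_map_map hη1.aemeasurable hη2.aemeasurable).1 hindep,
      Measure.map_apply hpair (hE.inter (measurable_snd hU))]
    rfl
  have h_all := h_inter Set.univ MeasurableSet.univ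
  rw [Set.preimage_univ, Set.inter_univ, Measure.restrict_univ] at h_all
  have h_law : ∀ x, P.map η1 ((fun y => (y, x)) ⁻¹' (f ⁻¹' S))
      = P.map (fun ω => f (η1 ω, x)) S := by
    intro x
    rw [Measure.map_apply hη1 (measurable_prodMk_right hE), Measure.map_apply (h_slice x) hS]
    rfl
  have h_prob : ∀ x, IsProbabilityMeasure (P.map fun ω => f (η1 ω, x)) := fun x =>
    Measure.isProbabilityMeasure_map (h_slice x).aemeasurable
  have h_int : Integrable
      (fun x => (P.map η1 ((fun y => (y, x)) ⁻¹' (f ⁻¹' S))).toReal) (P.map η2) := by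
    refine .of_bound (measurable_measure_prodMk_right hE).ennreal_toReal.aestronglyMeasurable 1
      (Filter.Eventually.of_forall fun x => ?_)
    rw [Real.norm_of_nonneg ENNReal.toReal_nonneg]
    exact measureReal_le_one
  have h_close : ∀ x, |(P.map η1 ((fun y => (y, x)) ⁻¹' (f ⁻¹' S))).toReal
      - (P.map (fun ω => f (η1 ω, x20)) S).toReal| ≤ δ + D.indicator 1 x := by
    intro x
    rw [h_law]
    by_cases hx : x ∈ D
    · have h_le : |(P.map (fun ω => f (η1 ω, x)) S).toReal
          - (P.map (fun ω => f (η1 ω, x20)) S).toReal| ≤ 1 :=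
        abs_sub_le_of_nonneg_of_le ENNReal.toReal_nonneg measureReal_le_one
          ENNReal.toReal_nonneg measureReal_le_one
      simp only [hx, Set.indicator_of_mem, Pi.one_apply]
      linarith
    · have h_lt := hx
      rw [hD, Set.mem_ofPred_eq, not_le] at h_lt
      simpa [hx] using (abs_sub_le_tvDist _ _ hS).trans h_lt.le
  have h_bound := abs_setIntegral_sub_integral_mul_le (T := T) _ h_int hDmeas h_close
  rw [← h_inter T hT, ← h_all, measureReal_def, measureReal_def, Measure.map_apply hη2 hT,
    Measure.map_apply hη2 hDmeas] at h_bound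
  exact h_bound
end

section
/- Let ε1, …, ε_{k0} be random variables and let Ξ be a random element of ℝ^∞ (the space of real sequences with its Borel σ-algebra) independent of the vector (ε1, …, ε_{k0}). Let R : ℝ^{k0} × ℝ^∞ → ℝ^m be Borel measurable, and suppose there are a Borel set D ⊆ ℝ^∞, a point z0 ∈ D, and β ≥ 0 such that for every z ∈ D, d_TV(law of R(ε_{k0}, …, ε1, z0), law of R(ε_{k0}, …, ε1, z)) ≤ β, where the map z ↦ d_TV is assumed measurable enough that the events below are measurable. Then the strong mixing coefficient α of the σ-algebras σ{Ξ} and σ{R(ε_{k0}, …, ε1, Ξ)} satisfies α ≤ 2β + 2·P(Ξ ∉ D). -/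
open MeasureTheory ProbabilityTheory

theorem tvDist_bddAbove {X : Type*} [MeasurableSpace X] (μ ν : Measure X)
    [IsProbabilityMeasure μ] [IsProbabilityMeasure ν] :
    BddAbove (Set.range fun A : {s : Set X // MeasurableSet s} =>
      |(μ A.1).toReal - (ν A.1).toReal|) := by
  refine ⟨1, ?_⟩
  rintro _ ⟨A, rfl⟩
  exact abs_sub_le_of_nonneg_of_le ENNReal.toReal_nonneg measureReal_le_one
    ENNReal.toReal_nonneg measureReal_le_one

theorem abs_measure_sub_le_tvDist {X : Type*} [MeasurableSpace X] (μ ν : Measure X)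
    [IsProbabilityMeasure μ] [IsProbabilityMeasure ν] {s : Set X} (hs : MeasurableSet s) :
    |(μ s).toReal - (ν s).toReal| ≤ tvDist μ ν :=
  le_ciSup (tvDist_bddAbove μ ν) (⟨s, hs⟩ : {s : Set X // MeasurableSet s})

/-- Disintegration of the probability of a joint event along an independent coordinate. -/
theorem toReal_measure_inter_eq_setIntegral {Ω X Y : Type*} [MeasurableSpace Ω]
    [MeasurableSpace X] [MeasurableSpace Y] (P : Measure Ω) [IsProbabilityMeasure P]
    {U : Ω → X} {V : Ω → Y} (hU : Measurable U) (hV : Measurable V) (h : IndepFun U V P)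
    {E : Set (X × Y)} (hE : MeasurableSet E) {s : Set Y} (hs : MeasurableSet s) :
    (P (V ⁻¹' s ∩ {ω | (U ω, V ω) ∈ E})).toReal =
      ∫ z in s, (P {ω | (U ω, z) ∈ E}).toReal ∂(P.map V) := by
  have : IsProbabilityMeasure (P.map U) := Measure.isProbabilityMeasure_map hU.aemeasurable
  have : IsProbabilityMeasure (P.map V) := Measure.isProbabilityMeasure_map hV.aemeasurable
  have hE' : MeasurableSet ((Prod.snd ⁻¹' s) ∩ E : Set (X × Y)) := (measurable_snd hs).inter hE
  have hfib (z : Y) : P {ω | (U ω, z) ∈ E} = P.map U ((fun x => (x, z)) ⁻¹' E) := by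
    rw [Measure.map_apply hU (measurable_prodMk_right hE)]
    rfl
  have hjoint : P (V ⁻¹' s ∩ {ω | (U ω, V ω) ∈ E}) =
      ((P.map U).prod (P.map V)) ((Prod.snd ⁻¹' s) ∩ E) := by
    rw [← (indepFun_iff_map_prod_eq_prod_map_map hU.aemeasurable hV.aemeasurable).1 h,
      Measure.map_apply (hU.prodMk hV) hE']
    rfl
  rw [hjoint, Measure.prod_apply_symm hE']
  simp_rw [hfib]
  rw [integral_toReal (measurable_measure_prodMk_right hE).aemeasurable
    (Filter.Eventually.of_forall fun _ => measure_lt_top _ _), ← lintegral_indicator hs]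
  congr 2
  ext z
  by_cases hz : z ∈ s <;> simp [Set.preimage_inter, Set.preimage_preimage, hz]

/-- If `f` takes values in `[0, 1]` and is within `β` of a constant `p ∈ [0, 1]` on `D`, then the
covariance of `f` with any indicator is at most `2 β + 2 ν Dᶜ`. -/
theorem abs_setIntegral_sub_mul_integral_le {Y : Type*} [MeasurableSpace Y] (ν : Measure Y)
    [IsProbabilityMeasure ν] {f : Y → ℝ} (hf : Integrable f ν) (hf0 : ∀ z, 0 ≤ f z)
    (hf1 : ∀ z, f z ≤ 1) {p β : ℝ} (hp0 : 0 ≤ p) (hp1 : p ≤ 1) (hβ : 0 ≤ β) {D : Set Y}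
    (hD : MeasurableSet D) (hfD : ∀ z ∈ D, |f z - p| ≤ β) (s : Set Y) :
    |∫ z in s, f z ∂ν - ν.real s * ∫ z, f z ∂ν| ≤ 2 * β + 2 * ν.real Dᶜ := by
  have hg : Integrable (fun z => f z - p) ν := hf.sub (integrable_const p)
  have hind : Integrable (Dᶜ.indicator fun _ => (1 : ℝ)) ν :=
    (integrable_const 1).indicator hD.compl
  have habs : ∫ z, |f z - p| ∂ν ≤ β + ν.real Dᶜ := by
    calc ∫ z, |f z - p| ∂ν ≤ ∫ z, (β + Dᶜ.indicator (fun _ => (1 : ℝ)) z) ∂ν := by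
          refine integral_mono hg.abs ((integrable_const β).add hind) fun z => ?_
          by_cases hz : z ∈ D
          · simpa [hz] using hfD z hz
          · have := abs_sub_le_of_nonneg_of_le (hf0 z) (hf1 z) hp0 hp1
            simp only [Set.mem_compl_iff, hz, not_false_eq_true, Set.indicator_of_mem]
            linarith
      _ = β + ν.real Dᶜ := by
          rw [integral_add (integrable_const β) hind, integral_indicator_const _ hD.compl]
          simp
  have hset : |∫ z in s, (f z - p) ∂ν| ≤ β + ν.real Dᶜ :=
    (abs_integral_le_integral_abs).trans <|
      (setIntegral_le_integral hg.abs (Filter.Eventually.of_forall fun _ => abs_nonneg _)).trans habs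
  have hall : |∫ z, (f z - p) ∂ν| ≤ β + ν.real Dᶜ := abs_integral_le_integral_abs.trans habs
  have hmul : |ν.real s * ∫ z, (f z - p) ∂ν| ≤ β + ν.real Dᶜ := by
    rw [abs_mul, abs_of_nonneg measureReal_nonneg]
    exact (mul_le_of_le_one_left (abs_nonneg _) measureReal_le_one).trans hall
  have hsplit : ∫ z in s, f z ∂ν - ν.real s * ∫ z, f z ∂ν =
      ∫ z in s, (f z - p) ∂ν - ν.real s * ∫ z, (f z - p) ∂ν := by
    rw [integral_sub hf.integrableOn (integrable_const p), integral_sub hf (integrable_const p)]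
    simp
    ring
  rw [hsplit]
  exact (abs_sub _ _).trans (by linarith)

/-- let `ε 0, …, ε (k0-1)` be random variables, `Ξ` a random element of
`ℝ^∞ = ℕ → ℝ` independent of the vector `(ε 0, …, ε (k0-1))`, and
`R : ℝ^{k0} × ℝ^∞ → ℝ^m` Borel.  If `D ⊆ ℝ^∞` is Borel, `z0 ∈ D`, `β ≥ 0`, and for every
`z ∈ D` the total variation distance between the laws of `R(ε, z0)` and `R(ε, z)` is at
most `β`, then the strong mixing coefficient of `σ{Ξ}` and `σ{R(ε, Ξ)}` is at most
`2β + 2 P(Ξ ∉ D)`. -/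
theorem stmt1
    {Ω : Type*} [MeasurableSpace Ω] (P : Measure Ω) [IsProbabilityMeasure P]
    (k0 m : ℕ) (ε : Fin k0 → Ω → ℝ) (Ξ : Ω → (ℕ → ℝ))
    (hε : ∀ i, Measurable (ε i)) (hΞ : Measurable Ξ)
    (hindep : IndepFun (fun ω => fun i => ε i ω) Ξ P)
    (R : (Fin k0 → ℝ) × (ℕ → ℝ) → (Fin m → ℝ)) (hR : Measurable R)
    (D : Set (ℕ → ℝ)) (hDmeas : MeasurableSet D)
    (z0 : ℕ → ℝ) (hz0 : z0 ∈ D) (β : ℝ) (hβ : 0 ≤ β)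
    (htv : ∀ z ∈ D,
      tvDist (P.map (fun ω => R (fun i => ε i ω, z0)))
          (P.map (fun ω => R (fun i => ε i ω, z))) ≤ β) :
    alphaMix P (MeasurableSpace.comap Ξ inferInstance)
        (MeasurableSpace.comap (fun ω => R (fun i => ε i ω, Ξ ω)) inferInstance)
      ≤ 2 * β + 2 * (P (Ξ ⁻¹' Dᶜ)).toReal := by
  have hU : Measurable fun ω => fun i => ε i ω := measurable_pi_lambda _ hε
  have hlaw (z : ℕ → ℝ) : Measurable fun ω => R (fun i => ε i ω, z) :=
    hR.comp (hU.prodMk measurable_const)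
  have (z : ℕ → ℝ) : IsProbabilityMeasure (P.map fun ω => R (fun i => ε i ω, z)) :=
    Measure.isProbabilityMeasure_map (hlaw z).aemeasurable
  have : IsProbabilityMeasure (P.map Ξ) := Measure.isProbabilityMeasure_map hΞ.aemeasurable
  refine Real.iSup_le ?_ (by positivity)
  intro q
  obtain ⟨⟨s, hs, hA⟩, ⟨t, ht, hB⟩⟩ := q.2
  rw [← hA, ← hB]
  have hfib : Measurable fun z => (P {ω | (fun i => ε i ω, z) ∈ R ⁻¹' t}).toReal := by
    have h : Measurable fun z : ℕ → ℝ =>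
        P.map (fun ω => fun i => ε i ω) ((fun e => (e, z)) ⁻¹' (R ⁻¹' t)) :=
      have := Measure.isProbabilityMeasure_map (μ := P) hU.aemeasurable
      measurable_measure_prodMk_right (hR ht)
    simp_rw [Measure.map_apply hU (measurable_prodMk_right (hR ht))] at h
    exact h.ennreal_toReal
  have hint : Integrable (fun z => (P {ω | (fun i => ε i ω, z) ∈ R ⁻¹' t}).toReal) (P.map Ξ) :=
    Integrable.of_bound hfib.aestronglyMeasurable 1 <| Filter.Eventually.of_forall fun z => by
      rw [Real.norm_of_nonneg ENNReal.toReal_nonneg]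
      exact measureReal_le_one
  have hdist : ∀ z ∈ D, |(P {ω | (fun i => ε i ω, z) ∈ R ⁻¹' t}).toReal -
      (P {ω | (fun i => ε i ω, z0) ∈ R ⁻¹' t}).toReal| ≤ β := fun z hz => by
    have h := (abs_measure_sub_le_tvDist _ _ ht).trans (htv z hz)
    rw [Measure.map_apply (hlaw z0) ht, Measure.map_apply (hlaw z) ht, abs_sub_comm] at h
    exact h
  have hcov := abs_setIntegral_sub_mul_integral_le (P.map Ξ) hint (fun _ => ENNReal.toReal_nonneg)
    (fun _ => measureReal_le_one) ENNReal.toReal_nonneg measureReal_le_one hβ hDmeas hdist s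
  have huniv := toReal_measure_inter_eq_setIntegral P hU hΞ hindep (hR ht) MeasurableSet.univ
  rw [Set.preimage_univ, Set.univ_inter, setIntegral_univ] at huniv
  rw [← toReal_measure_inter_eq_setIntegral P hU hΞ hindep (hR ht) hs, ← huniv, measureReal_def,
    measureReal_def, Measure.map_apply hΞ hs, Measure.map_apply hΞ hDmeas.compl] at hcov
  exact hcov
end
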